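/- Let S = {|S_j⟩ = |A_j⟩⊗|B_j⟩⊗|C_j⟩ : j = 1,…,5} be a family of five mutually orthonormal product vectors in ℂ²⊗ℂ²⊗ℂ². Then the span of S is extendible: there exists a nonzero product vector |a⟩⊗|b⟩⊗|c⟩ orthogonal to all five vectors |S_j⟩. Equivalently, no three-qubit unextendible product basis has five members. -/

import Mathlib

noncomputable section

open Matrix Finset
open scoped ComplexOrder

/-- one-qubit vectors -/
abbrev V2 := Fin 2 → ℂ
/-- index set of the three-qubit space ℂ²⊗ℂ²⊗ℂ² -/
abbrev I8 := Fin 2 × Fin 2 × Fin 2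
/-- three-qubit vectors -/
abbrev V8 := I8 → ℂ
/-- one-qubit operators -/
abbrev M2 := Matrix (Fin 2) (Fin 2) ℂ
/-- three-qubit operators -/
abbrev M8 := Matrix I8 I8 ℂ

/-- inner product on ℂ², conjugate-linear in the first argument -/
def inner2 (u v : V2) : ℂ := ∑ i, star (u i) * v i

/-- inner product on ℂ²⊗ℂ²⊗ℂ², conjugate-linear in the first argument -/
def inner8 (u v : V8) : ℂ := ∑ p, star (u p) * v p

/-- tensor product |a⟩⊗|b⟩⊗|c⟩ of three one-qubit vectors -/
def tp3 (a b c : V2) : V8 := fun p => a p.1 * b p.2.1 * c p.2.2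

/-- Kronecker (tensor) product X_A⊗X_B⊗X_C of three one-qubit operators -/
def kron3 (X Y Z : M2) : M8 :=
  Matrix.of fun p q => X p.1 q.1 * Y p.2.1 q.2.1 * Z p.2.2 q.2.2

/-- a product operator on three qubits -/
def IsProductOp (X : M8) : Prop := ∃ XA XB XC : M2, X = kron3 XA XB XC

/-- the projector |v⟩⟨v| onto a vector -/
def proj8 (v : V8) : M8 := Matrix.vecMulVec v (star v)

/-- A three-qubit unextendible product basis with `n` members: mutually orthonormal
product vectors (products of unit vectors) such that the orthogonal complement of
their span contains no nonzero product vector. -/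
structure UPB (n : ℕ) where
  S : Fin n → V8
  prod : ∀ j, ∃ a b c : V2,
    inner2 a a = 1 ∧ inner2 b b = 1 ∧ inner2 c c = 1 ∧ S j = tp3 a b c
  ortho : ∀ i j, inner8 (S i) (S j) = if i = j then 1 else 0
  unext : ∀ a b c : V2, (∀ j, inner8 (S j) (tp3 a b c) = 0) → tp3 a b c = 0

/-- the bound entangled state ρ_S = (1/(8-n))(I - Σ_j |S_j⟩⟨S_j|) associated with a UPB -/
def upbState {n : ℕ} (U : UPB n) : M8 :=
  ((8 : ℂ) - (n : ℂ))⁻¹ • ((1 : M8) - ∑ j, proj8 (U.S j))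

/-- equivalence of four-member UPBs: related by local unitaries and a permutation of members -/
def UPB.Equiv (S T : UPB 4) : Prop :=
  ∃ UA UB UC : M2, UA ∈ Matrix.unitaryGroup (Fin 2) ℂ ∧
    UB ∈ Matrix.unitaryGroup (Fin 2) ℂ ∧ UC ∈ Matrix.unitaryGroup (Fin 2) ℂ ∧
    ∃ σ : Equiv.Perm (Fin 4), ∀ j, S.S j = (kron3 UA UB UC).mulVec (T.S (σ j))

/-- square root of a positive semidefinite matrix (junk value 0 otherwise) -/
def msqrt {m : Type*} [Fintype m] [DecidableEq m] (A : Matrix m m ℂ) : Matrix m m ℂ :=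
  open scoped Classical in if h : A.PosSemidef then
    (h.1.eigenvectorUnitary : Matrix m m ℂ) *
      Matrix.diagonal ((↑) ∘ Real.sqrt ∘ h.1.eigenvalues : m → ℂ) *
      (star h.1.eigenvectorUnitary : Matrix m m ℂ)
    else 0

/-- fidelity F(ρ,σ) = tr √(√ρ σ √ρ) of positive semidefinite matrices -/
def fidelity {m : Type*} [Fintype m] [DecidableEq m] (ρ σ : Matrix m m ℂ) : ℝ :=
  ((msqrt (msqrt ρ * σ * msqrt ρ)).trace).re

theorem inner8_tp3 (a b c a' b' c' : V2) :
    inner8 (tp3 a b c) (tp3 a' b' c') = inner2 a a' * inner2 b b' * inner2 c c' := by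
  simp only [inner8, inner2, tp3, Fintype.sum_prod_type, Fin.sum_univ_two, star_mul']
  ring

theorem inner2_comm_eq_zero {u v : V2} (h : inner2 u v = 0) : inner2 v u = 0 := by
  have := congrArg star h
  simp only [inner2, star_sum, star_mul', star_star, star_zero] at this
  simpa only [inner2, mul_comm] using this

theorem ne_zero_of_inner2_self {u : V2} (h : inner2 u u = 1) : u ≠ 0 := by
  rintro rfl
  simp [inner2] at h

theorem tp3_ne_zero {a b c : V2} (ha : a ≠ 0) (hb : b ≠ 0) (hc : c ≠ 0) : tp3 a b c ≠ 0 := by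
  obtain ⟨i, hi⟩ := Function.ne_iff.1 ha
  obtain ⟨j, hj⟩ := Function.ne_iff.1 hb
  obtain ⟨k, hk⟩ := Function.ne_iff.1 hc
  exact Function.ne_iff.2 ⟨(i, j, k), mul_ne_zero (mul_ne_zero hi hj) hk⟩

theorem exists_ne_zero_inner2_eq_zero {u : V2} (hu : u ≠ 0) : ∃ x : V2, x ≠ 0 ∧ inner2 u x = 0 := by
  refine ⟨![-star (u 1), star (u 0)], fun h => hu ?_, ?_⟩
  · have h0 := congrFun h 0
    have h1 := congrFun h 1
    ext i
    fin_cases i <;> simp_all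
  · simp [inner2, Fin.sum_univ_two]
    ring

/-- The orthogonal complement of a one-qubit vector. -/
def perpSet (u : V2) : Set V2 := {x | inner2 u x = 0}

/-- In ℂ² two vectors orthogonal to a common nonzero vector are proportional. -/
theorem perpSet_subset {u v w : V2} (hu : u ≠ 0) (hv : v ≠ 0)
    (huv : inner2 u v = 0) (huw : inner2 u w = 0) : perpSet v ⊆ perpSet w := by
  intro x hx
  simp only [perpSet, Set.mem_ofPred_eq, inner2, Fin.sum_univ_two] at *
  have hdet : v 0 * w 1 = v 1 * w 0 := by
    by_cases h0 : u 0 = 0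
    · have h1 : star (u 1) ≠ 0 := fun h => hu (by ext i; fin_cases i <;> simp_all)
      refine mul_left_cancel₀ h1 ?_
      linear_combination v 0 * huw - w 0 * huv
    · have h1 : star (u 0) ≠ 0 := star_ne_zero.2 h0
      refine mul_left_cancel₀ h1 ?_
      linear_combination w 1 * huv - v 1 * huw
  have hdet' : star (v 0) * star (w 1) = star (v 1) * star (w 0) := by
    simpa only [star_mul'] using congrArg star hdet
  by_cases h0 : v 0 = 0
  · have h1 : star (v 1) ≠ 0 := fun h => hv (by ext i; fin_cases i <;> simp_all)
    refine (mul_eq_zero.1 ?_).resolve_left h1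
    linear_combination star (w 1) * hx - x 0 * hdet'
  · refine (mul_eq_zero.1 ?_).resolve_left (star_ne_zero.2 h0)
    linear_combination star (w 0) * hx + x 1 * hdet'

theorem perpSet_eq {u v w : V2} (hu : u ≠ 0) (hv : v ≠ 0) (hw : w ≠ 0)
    (huv : inner2 u v = 0) (huw : inner2 u w = 0) : perpSet v = perpSet w :=
  (perpSet_subset hu hv huv huw).antisymm (perpSet_subset hu hw huw huv)

section Combinatorics

variable {R : Type*} {r : Fin 3 → Fin 5 → R} {o : Fin 3 → Fin 5 → Fin 5 → Prop}

/-- Each party meets every member assigned to it in a single ray, so one product vector is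
orthogonal to all members. -/
def Covered (r : Fin 3 → Fin 5 → R) : Prop :=
  ∃ q : Fin 5 → Fin 3, ∀ i j, q i = q j → r (q i) i = r (q i) j

theorem covered_of_triple {p : Fin 3} {i j k : Fin 5} (hij : i ≠ j) (hik : i ≠ k) (hjk : j ≠ k)
    (h₁ : r p i = r p j) (h₂ : r p i = r p k) : Covered r := by
  obtain ⟨m, n, hmn⟩ : ∃ m n, ∀ x, x = i ∨ x = j ∨ x = k ∨ x = m ∨ x = n := by
    clear h₁ h₂; revert i j k; decide
  have hp : p + 1 ≠ p ∧ p + 2 ≠ p ∧ p + 1 ≠ p + 2 := by clear h₁ h₂; revert p; decide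
  refine ⟨fun x => if x = m then p + 1 else if x = n then p + 2 else p, fun x y hxy => ?_⟩
  have := hmn x
  have := hmn y
  grind

theorem covered_of_pairs {p p' : Fin 3} (hp : p ≠ p') {i j k l : Fin 5} (hij : i ≠ j)
    (hik : i ≠ k) (hil : i ≠ l) (hjk : j ≠ k) (hjl : j ≠ l) (hkl : k ≠ l)
    (h₁ : r p i = r p j) (h₂ : r p' k = r p' l) : Covered r := by
  obtain ⟨m, hm⟩ : ∃ m, ∀ x, x = i ∨ x = j ∨ x = k ∨ x = l ∨ x = m := by
    clear h₁ h₂; revert i j k l; decide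
  obtain ⟨p'', hp'⟩ : ∃ p'', p'' ≠ p ∧ p'' ≠ p' := by clear h₁ h₂ hp; revert p p'; decide
  refine ⟨fun x => if x = i ∨ x = j then p else if x = k ∨ x = l then p' else p'',
    fun x y hxy => ?_⟩
  have := hm x
  have := hm y
  grind

theorem exists_two_neighbours (hcomplete : ∀ i j, i ≠ j → ∃ p, o p i j) (v : Fin 5) :
    ∃ p a b, a ≠ b ∧ o p v a ∧ o p v b := by
  choose! f hf using fun u (hu : v ≠ u) => hcomplete v u hu
  obtain ⟨a, ha, b, hb, hab, h⟩ := Finset.exists_ne_map_eq_of_card_lt_of_maps_to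
    (s := univ.erase v) (t := univ) (f := f) (by simp) (by simp)
  have hb' := hf b (Finset.ne_of_mem_erase hb).symm
  exact ⟨f a, a, b, hab, hf a (Finset.ne_of_mem_erase ha).symm, h ▸ hb'⟩

/-- If all members are pairwise orthogonal, then in one party some four of them form two
mutually orthogonal pairs of parallel vectors. -/
theorem exists_parallel_pairs (hsymm : ∀ p i j, o p i j → o p j i) (hirrefl : ∀ p i, ¬ o p i i)
    (hray : ∀ p i j k, o p i j → o p i k → r p j = r p k)
    (hcongr : ∀ p i j k, o p i j → r p j = r p k → o p i k)
    (hcomplete : ∀ i j, i ≠ j → ∃ p, o p i j) :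
    ∃ p i j k l, i ≠ j ∧ k ≠ l ∧ r p i = r p j ∧ r p k = r p l ∧ o p i k := by
  choose f a b hab ha hb using exists_two_neighbours hcomplete
  obtain ⟨v, w, hvw, h⟩ := Fintype.exists_ne_map_eq_of_card_lt f (by simp)
  have hav := ha v
  have hbv := hb v
  have haw := ha w
  have hbw := hb w
  rw [← h] at haw hbw
  generalize f v = p at *
  have habv := hab v
  have habw := hab w
  generalize a v = x at *
  generalize b v = y at *
  generalize a w = z at *
  generalize b w = t at *
  have hxy := hray _ _ _ _ hav hbv
  have hzt := hray _ _ _ _ haw hbw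
  by_cases hr : r p v = r p w
  · exact ⟨p, v, w, x, y, hvw, habv, hr, hxy, hav⟩
  by_cases ho : o p v w
  · refine ⟨p, x, y, z, t, habv, habw, hxy, hzt, ?_⟩
    exact hcongr _ _ _ _ (hsymm _ _ _ hav) (hray _ _ _ _ (hsymm _ _ _ ho) haw)
  have hcard : ∀ v w x y z t : Fin 5, v ≠ w → v ≠ x → v ≠ y → v ≠ z → v ≠ t → w ≠ x → w ≠ y →
      w ≠ z → w ≠ t → x ≠ y → x ≠ z → x ≠ t → y ≠ z → y ≠ t → z ≠ t → False := by
    intros; omega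
  have hself : ∀ i j, o p i j → i ≠ j := by rintro i _ hij rfl; exact hirrefl _ _ hij
  have hcommon : ∀ i j, o p v i → o p w j → i ≠ j := by
    rintro i _ hi hj rfl
    exact hr (hray _ _ _ _ (hsymm _ _ _ hi) (hsymm _ _ _ hj))
  have hw : ∀ i, o p v i → w ≠ i := by rintro _ hi rfl; exact ho hi
  have hv : ∀ i, o p w i → v ≠ i := by rintro _ hi rfl; exact ho (hsymm _ _ _ hi)
  exact (hcard v w x y z t hvw (hself _ _ hav) (hself _ _ hbv) (hv _ haw) (hv _ hbw)
    (hw _ hav) (hw _ hbv) (hself _ _ haw) (hself _ _ hbw) habv (hcommon _ _ hav haw)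
    (hcommon _ _ hav hbw) (hcommon _ _ hbv haw) (hcommon _ _ hbv hbw) habw).elim

theorem covered_of_complete (hsymm : ∀ p i j, o p i j → o p j i) (hirrefl : ∀ p i, ¬ o p i i)
    (hray : ∀ p i j k, o p i j → o p i k → r p j = r p k)
    (hcongr : ∀ p i j k, o p i j → r p j = r p k → o p i k)
    (hcomplete : ∀ i j, i ≠ j → ∃ p, o p i j) : Covered r := by
  obtain ⟨p, i, j, k, l, hij, hkl, hrij, hrkl, hik⟩ :=
    exists_parallel_pairs hsymm hirrefl hray hcongr hcomplete
  by_contra hcov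
  have hself : ∀ p i j, o p i j → i ≠ j := by rintro p i _ hij rfl; exact hirrefl _ _ hij
  have hil := hcongr _ _ _ _ hik hrkl
  have hjk := hsymm _ _ _ (hcongr _ _ _ _ (hsymm _ _ _ hik) hrij)
  have hjl := hcongr _ _ _ _ hjk hrkl
  obtain ⟨m, hmi, hmj, hmk, hml⟩ : ∃ m, m ≠ i ∧ m ≠ j ∧ m ≠ k ∧ m ≠ l := by
    have h : ∀ i j k l : Fin 5, ∃ m, m ≠ i ∧ m ≠ j ∧ m ≠ k ∧ m ≠ l := by decide
    exact h i j k l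
  have hinj : ∀ p', p ≠ p' → ∀ x y, x ≠ y → x ≠ k → x ≠ l → y ≠ k → y ≠ l →
      r p' x ≠ r p' y := fun p' hp x y hxy hxk hxl hyk hyl h =>
    hcov (covered_of_pairs hp hkl hxk.symm hyk.symm hxl.symm hyl.symm hxy hrkl h)
  have hmi' : ¬ o p i m := fun h =>
    hcov (covered_of_triple hmk hml hkl (hray _ _ _ _ h hik) (hray _ _ _ _ h hil))
  have hmj' : ¬ o p j m := fun h =>
    hcov (covered_of_triple hmk hml hkl (hray _ _ _ _ h hjk) (hray _ _ _ _ h hjl))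
  have hij' : ¬ o p i j := fun h => hirrefl _ _ (hcongr _ _ _ _ h hrij.symm)
  have hik := hself _ _ _ hik
  have hil := hself _ _ _ hil
  have hjk := hself _ _ _ hjk
  have hjl := hself _ _ _ hjl
  -- Each of the two remaining parties separates `i`, `j` and `m`.
  have hunique : ∀ q, p ≠ q → (o q i m → ¬ o q j m) ∧ (o q i j → ¬ o q i m ∧ ¬ o q j m) := by
    intro q hq
    refine ⟨fun h h' => ?_, fun h => ⟨fun h' => ?_, fun h' => ?_⟩⟩
    · exact hinj q hq i j hij hik hil hjk hjl (hray _ _ _ _ (hsymm _ _ _ h) (hsymm _ _ _ h'))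
    · exact hinj q hq j m hmj.symm hjk hjl hmk hml (hray _ _ _ _ h h')
    · exact hinj q hq i m hmi.symm hik hil hmk hml (hray _ _ _ _ (hsymm _ _ _ h) h')
  obtain ⟨q₁, h₁⟩ := hcomplete i m hmi.symm
  obtain ⟨q₂, h₂⟩ := hcomplete j m hmj.symm
  obtain ⟨q₃, h₃⟩ := hcomplete i j hij
  have hp₁ : p ≠ q₁ := by rintro rfl; exact hmi' h₁
  have hp₂ : p ≠ q₂ := by rintro rfl; exact hmj' h₂
  have hp₃ : p ≠ q₃ := by rintro rfl; exact hij' h₃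
  have h₁₂ : q₁ ≠ q₂ := by rintro rfl; exact (hunique _ hp₁).1 h₁ h₂
  have h₁₃ : q₁ ≠ q₃ := by rintro rfl; exact ((hunique _ hp₁).2 h₃).1 h₁
  have h₂₃ : q₂ ≠ q₃ := by rintro rfl; exact ((hunique _ hp₂).2 h₃).2 h₂
  omega

end Combinatorics

/-- any family of five mutually orthonormal product vectors in
ℂ²⊗ℂ²⊗ℂ² is extendible: some nonzero product vector is orthogonal to all five.
Equivalently, no three-qubit UPB has five members. -/
theorem stmt19 (A B C : Fin 5 → V2)
    (hunit : ∀ j, inner2 (A j) (A j) = 1 ∧ inner2 (B j) (B j) = 1 ∧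
      inner2 (C j) (C j) = 1)
    (hortho : ∀ i j, inner8 (tp3 (A i) (B i) (C i)) (tp3 (A j) (B j) (C j)) =
      if i = j then 1 else 0) :
    ∃ a b c : V2, tp3 a b c ≠ 0 ∧
      ∀ j, inner8 (tp3 (A j) (B j) (C j)) (tp3 a b c) = 0 := by
  let V : Fin 3 → Fin 5 → V2 := ![A, B, C]
  have hV : ∀ p j, V p j ≠ 0 := by
    intro p j
    obtain ⟨hA, hB, hC⟩ := hunit j
    fin_cases p
    exacts [ne_zero_of_inner2_self hA, ne_zero_of_inner2_self hB, ne_zero_of_inner2_self hC]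
  have hself : ∀ p j, inner2 (V p j) (V p j) ≠ 0 := by
    intro p j
    obtain ⟨hA, hB, hC⟩ := hunit j
    fin_cases p <;> simp [V, hA, hB, hC]
  have hcomplete : ∀ i j, i ≠ j → ∃ p, inner2 (V p i) (V p j) = 0 := by
    intro i j hij
    have h := hortho i j
    rw [inner8_tp3, if_neg hij, mul_eq_zero, mul_eq_zero] at h
    rcases h with (h | h) | h
    exacts [⟨0, h⟩, ⟨1, h⟩, ⟨2, h⟩]
  obtain ⟨q, hq⟩ := covered_of_complete (r := fun p i => perpSet (V p i))
    (o := fun p i j => inner2 (V p i) (V p j) = 0)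
    (fun p i j h => inner2_comm_eq_zero h) hself
    (fun p i j k hj hk => perpSet_eq (hV p i) (hV p j) (hV p k) hj hk)
    (fun p i j k hj h => inner2_comm_eq_zero
      (show V p i ∈ perpSet (V p k) from h ▸ inner2_comm_eq_zero hj))
    hcomplete
  have hx : ∀ p, ∃ x : V2, x ≠ 0 ∧ ∀ j, q j = p → inner2 (V p j) x = 0 := by
    intro p
    by_cases h : ∃ i, q i = p
    · obtain ⟨i, rfl⟩ := h
      obtain ⟨x, hx, hix⟩ := exists_ne_zero_inner2_eq_zero (hV (q i) i)
      exact ⟨x, hx, fun j hj => (hq i j hj.symm).subset hix⟩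
    · exact ⟨V p 0, hV p 0, fun j hj => (h ⟨j, hj⟩).elim⟩
  choose x hx0 hx using hx
  refine ⟨x 0, x 1, x 2, tp3_ne_zero (hx0 0) (hx0 1) (hx0 2), fun j => ?_⟩
  rw [inner8_tp3]
  have h := hx (q j) j rfl
  generalize q j = p at h
  fin_cases p <;> simp_all [V]
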